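/- arXiv:2601.20754 — 3 statements merged into one kernel-verified Lean document; each statement's English description precedes it below -/
import Mathlib

section
/- Let m ≥ 1, k ≥ 1 and l be integers with l > k + m − 2, and let λ̃ = (λ_n)_{n=1}^{l} ⊂ (0, ∞). Then there exists a k-quasi-m-isometric completion with initial weights λ̃ if and only if both of the following hold: (a) Σ_{j=0}^{m} (−1)^j binom(m,j) (βλ̃)_{k+n+j} = 0 for every integer n with 0 ≤ n ≤ l − (k+m) (vacuously true when l < k+m); and (b) the unique real polynomial w of degree at most m−1 with w(n) = (βλ̃)_{k+n} for n = 0, 1, …, m−1 satisfies w(n) > 0 for every integer n ≥ m. Furthermore, in that case the completion is a strict k-quasi-m-isometric completion if and only if the degree of w is exactly m−1. -/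
noncomputable section

variable {E : Type*} [NormedAddCommGroup E] [InnerProductSpace ℂ E] [CompleteSpace E]

/-- `B_m(T) = Σ_{j=0}^m (−1)^j C(m,j) T*^(m−j) T^(m−j)`. -/
def Bop (m : ℕ) (T : E →L[ℂ] E) : E →L[ℂ] E :=
  ∑ j ∈ Finset.range (m + 1),
    ((-1 : ℂ) ^ j * (m.choose j : ℂ)) •
      ((ContinuousLinearMap.adjoint T) ^ (m - j) * T ^ (m - j))

/-- `T` is `k`-quasi-`m`-isometric if `T*^k B_m(T) T^k = 0`. -/
def IsQuasiIsometric (k m : ℕ) (T : E →L[ℂ] E) : Prop :=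
  (ContinuousLinearMap.adjoint T) ^ k * Bop m T * T ^ k = 0

/-- The Hilbert space ℓ²(ℕ). -/
abbrev ellTwo : Type := lp (fun _ : ℕ => ℂ) 2

/-- The standard orthonormal basis vectors of ℓ²(ℕ). -/
def stdVec (n : ℕ) : ellTwo := lp.single 2 n 1

/-- `S` is the unilateral weighted shift with weights `(λ_n)_{n ≥ 1}`:
`S e_n = λ_{n+1} e_{n+1}`. -/
def IsWeightedShift (lam : ℕ → ℝ) (S : ellTwo →L[ℂ] ellTwo) : Prop :=
  ∀ n : ℕ, S (stdVec n) = (lam (n + 1) : ℂ) • stdVec (n + 1)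

/-- `(βλ)_s = Π_{i=1}^s λ_i²` (with `(βλ)_0 = 1`). -/
def betaSeq (lam : ℕ → ℝ) (s : ℕ) : ℝ :=
  ∏ i ∈ Finset.Icc 1 s, (lam i) ^ 2

/-- `lam'` is a completion of the initial weight data `lam` given on indices `1, …, l`:
it is a bounded sequence of positive reals agreeing with `lam` on `1, …, l`. -/
def IsWeightCompletion (l : ℕ) (lam lam' : ℕ → ℝ) : Prop :=
  (∀ n : ℕ, 0 < lam' n) ∧ (∃ C : ℝ, ∀ n : ℕ, lam' n ≤ C) ∧
    ∀ n : ℕ, 1 ≤ n → n ≤ l → lam' n = lam n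

/-- alternating binomial sum -/
def altD (m : ℕ) (f : ℕ → ℝ) (n : ℕ) : ℝ :=
  ∑ j ∈ Finset.range (m + 1), (-1 : ℝ) ^ j * (m.choose j : ℝ) * f (n + j)

lemma altD_reflect (m : ℕ) (f : ℕ → ℝ) (n : ℕ) :
    ∑ j ∈ Finset.range (m + 1), (-1 : ℝ) ^ j * (m.choose j : ℝ) * f (n + (m - j))
      = (-1) ^ m * altD m f n := by
  unfold altD
  rw [← Finset.sum_range_reflect, Finset.mul_sum]
  apply Finset.sum_congr rfl
  intro j hj
  have hj' : j ≤ m := Nat.lt_succ_iff.mp (Finset.mem_range.mp hj)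
  have e1 : m + 1 - 1 - j = m - j := by omega
  have e2 : m - (m - j) = j := by omega
  rw [e1, e2, Nat.choose_symm hj']
  have : (-1 : ℝ) ^ (m - j) = (-1) ^ m * (-1) ^ j := by
    have h1 : (-1 : ℝ) ^ m = (-1) ^ (m - j) * (-1) ^ j := by
      rw [← pow_add]; congr 1; omega
    rw [h1, mul_assoc, ← mul_pow]; simp
  rw [this]; ring

lemma altD_fwd (m : ℕ) (w : Polynomial ℝ) (n : ℕ) :
    (fwdDiff 1)^[m] w.eval (n : ℝ) = (-1) ^ m * altD m (fun i => w.eval (i : ℝ)) n := by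
  rw [fwdDiff_iter_eq_sum_shift]
  unfold altD
  rw [Finset.mul_sum]
  apply Finset.sum_congr rfl
  intro j hj
  have hj' : j ≤ m := Nat.lt_succ_iff.mp (Finset.mem_range.mp hj)
  have : (-1 : ℝ) ^ (m - j) = (-1) ^ m * (-1) ^ j := by
    have h1 : (-1 : ℝ) ^ m = (-1) ^ (m - j) * (-1) ^ j := by
      rw [← pow_add]; congr 1; omega
    rw [h1, mul_assoc, ← mul_pow]; simp
  rw [zsmul_eq_mul]
  push_cast
  rw [this]
  simp only [nsmul_eq_mul, mul_one]
  ring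

lemma altD_poly_zero {m : ℕ} {w : Polynomial ℝ} (h : w.natDegree < m) (n : ℕ) :
    altD m (fun i => w.eval (i : ℝ)) n = 0 := by
  have h1 := altD_fwd m w n
  rw [Polynomial.fwdDiff_iter_eq_zero_of_degree_lt h] at h1
  simpa using h1.symm

lemma altD_poly_ne {w : Polynomial ℝ} (h : w ≠ 0) (n : ℕ) :
    altD w.natDegree (fun i => w.eval (i : ℝ)) n ≠ 0 := by
  have h1 := altD_fwd w.natDegree w n
  rw [Polynomial.fwdDiff_iter_degree_eq_factorial] at h1
  intro h2
  rw [h2] at h1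
  simp [h, Nat.factorial_ne_zero] at h1

lemma agree_of_altD {m N : ℕ} {f g : ℕ → ℝ} (h0 : ∀ n, n < m → f n = g n)
    (hf : ∀ n, n + m ≤ N → altD m f n = 0) (hg : ∀ n, n + m ≤ N → altD m g n = 0) :
    ∀ n, n ≤ N → f n = g n := by
  intro n
  induction n using Nat.strong_induction_on with
  | _ n ih =>
    intro hn
    by_cases hnm : n < m
    · exact h0 n hnm
    · obtain ⟨t, rfl⟩ : ∃ t, n = t + m := ⟨n - m, by omega⟩
      have h1 := hf t hn
      have h2 := hg t hn
      unfold altD at h1 h2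
      rw [Finset.sum_range_succ] at h1 h2
      have h3 : ∑ j ∈ Finset.range m, (-1 : ℝ) ^ j * (m.choose j : ℝ) * f (t + j)
          = ∑ j ∈ Finset.range m, (-1 : ℝ) ^ j * (m.choose j : ℝ) * g (t + j) := by
        apply Finset.sum_congr rfl
        intro j hj
        have := Finset.mem_range.mp hj
        rw [ih (t + j) (by omega) (by omega)]
      rw [h3] at h1
      simp only [Nat.choose_self, Nat.cast_one, mul_one] at h1 h2
      have h4 : (-1 : ℝ) ^ m * f (t + m) = (-1 : ℝ) ^ m * g (t + m) := by linarith
      exact mul_left_cancel₀ (pow_ne_zero _ (by norm_num)) h4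

lemma exists_interp {m : ℕ} (hm : 1 ≤ m) (f : ℕ → ℝ) :
    ∃ w : Polynomial ℝ, w.natDegree ≤ m - 1 ∧ ∀ n : ℕ, n ≤ m - 1 → w.eval (n : ℝ) = f n := by
  have hinj : Set.InjOn (fun i : ℕ => (i : ℝ)) (Finset.range m : Set ℕ) :=
    fun a _ b _ h => Nat.cast_injective (R := ℝ) h
  refine ⟨Lagrange.interpolate (Finset.range m) (fun i : ℕ => (i : ℝ)) f, ?_, ?_⟩
  · have h := Lagrange.degree_interpolate_lt f hinj
    rw [Finset.card_range] at h
    by_cases h0 : Lagrange.interpolate (Finset.range m) (fun i : ℕ => (i : ℝ)) f = 0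
    · rw [h0]; simp
    · have := (Polynomial.natDegree_lt_iff_degree_lt h0).2 h
      omega
  · intro n hn
    exact Lagrange.eval_interpolate_at_node f hinj (Finset.mem_range.mpr (by omega))

lemma betaSeq_succ (lam : ℕ → ℝ) (s : ℕ) :
    betaSeq lam (s + 1) = betaSeq lam s * lam (s + 1) ^ 2 := by
  unfold betaSeq
  rw [Finset.prod_Icc_succ_top (by omega)]

lemma betaSeq_pos {lam : ℕ → ℝ} {s : ℕ} (h : ∀ n, 1 ≤ n → n ≤ s → 0 < lam n) :
    0 < betaSeq lam s := by
  apply Finset.prod_pos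
  intro i hi
  have := Finset.mem_Icc.mp hi
  exact pow_pos (h i this.1 this.2) 2

lemma betaSeq_congr {lam lam' : ℕ → ℝ} {s : ℕ} (h : ∀ n, 1 ≤ n → n ≤ s → lam' n = lam n) :
    betaSeq lam' s = betaSeq lam s := by
  apply Finset.prod_congr rfl
  intro i hi
  have := Finset.mem_Icc.mp hi
  rw [h i this.1 this.2]

lemma shift_pow {lam : ℕ → ℝ} {S : ellTwo →L[ℂ] ellTwo} (hS : IsWeightedShift lam S)
    (hpos : ∀ n, 0 < lam n) (p a : ℕ) :
    ∃ c : ℝ, (S ^ p) (stdVec a) = (c : ℂ) • stdVec (a + p) ∧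
      betaSeq lam a * c ^ 2 = betaSeq lam (a + p) := by
  induction p with
  | zero => exact ⟨1, by simp, by simp⟩
  | succ p ih =>
    obtain ⟨c, h1, h2⟩ := ih
    refine ⟨c * lam (a + p + 1), ?_, ?_⟩
    · rw [pow_succ', ContinuousLinearMap.mul_apply, h1, map_smul, hS, smul_smul]
      push_cast
      rfl
    · rw [← add_assoc, betaSeq_succ, ← h2]; ring

lemma inner_stdVec (a : ℕ) (x : ellTwo) : inner ℂ (stdVec a) x = x a := by
  unfold stdVec
  rw [lp.inner_single_left]
  simp

lemma stdVec_self (a : ℕ) : (stdVec a : ellTwo) a = 1 := by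
  unfold stdVec; simp

lemma stdVec_ne {a b : ℕ} (h : a ≠ b) : (stdVec a : ellTwo) b = 0 := by
  unfold stdVec; exact lp.single_apply_ne _ _ _ h.symm

lemma op_zero_of {A : ellTwo →L[ℂ] ellTwo}
    (h : ∀ a b, inner ℂ (stdVec a) (A (stdVec b)) = 0) : A = 0 := by
  have h1 : ∀ b, A (stdVec b) = 0 := by
    intro b
    ext a
    rw [← inner_stdVec, h]; rfl
  ext1 f
  have h2 := (lp.hasSum_single (p := 2) (by simp) f).mapL A
  have h3 : ∀ i, A (lp.single 2 i (f i)) = 0 := by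
    intro i
    have : lp.single 2 i (f i) = (f i) • stdVec i := by
      unfold stdVec
      rw [← lp.single_smul]; simp
    rw [this, map_smul, h1, smul_zero]
  simp only [h3] at h2
  exact h2.unique hasSum_zero

lemma adj_pow (S : ellTwo →L[ℂ] ellTwo) (p : ℕ) :
    (ContinuousLinearMap.adjoint S) ^ p = ContinuousLinearMap.adjoint (S ^ p) := by
  rw [← ContinuousLinearMap.star_eq_adjoint, ← ContinuousLinearMap.star_eq_adjoint, star_pow]

lemma inner_quasi (k m : ℕ) (S : ellTwo →L[ℂ] ellTwo) (x y : ellTwo) :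
    inner ℂ x (((ContinuousLinearMap.adjoint S) ^ k * Bop m S * S ^ k) y) =
      ∑ j ∈ Finset.range (m + 1), ((-1 : ℂ) ^ j * (m.choose j : ℂ)) *
        inner ℂ ((S ^ (k + (m - j))) x) ((S ^ (k + (m - j))) y) := by
  simp only [ContinuousLinearMap.mul_apply, Bop]
  rw [adj_pow, ContinuousLinearMap.adjoint_inner_right, ContinuousLinearMap.sum_apply, inner_sum]
  apply Finset.sum_congr rfl
  intro j _
  rw [ContinuousLinearMap.smul_apply, inner_smul_right, ContinuousLinearMap.mul_apply, adj_pow,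
    ContinuousLinearMap.adjoint_inner_right, add_comm k, pow_add, ContinuousLinearMap.mul_apply,
    ContinuousLinearMap.mul_apply]

lemma quasi_iff {lam : ℕ → ℝ} {S : ellTwo →L[ℂ] ellTwo} (hS : IsWeightedShift lam S)
    (hpos : ∀ n, 0 < lam n) (k m : ℕ) :
    IsQuasiIsometric k m S ↔ ∀ n, altD m (fun i => betaSeq lam (k + i)) n = 0 := by
  have key : ∀ n, (betaSeq lam n : ℂ) *
      inner ℂ (stdVec n) (((ContinuousLinearMap.adjoint S) ^ k * Bop m S * S ^ k) (stdVec n))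
      = (((-1) ^ m * altD m (fun i => betaSeq lam (k + i)) n : ℝ) : ℂ) := by
    intro n
    rw [← altD_reflect, inner_quasi, Finset.mul_sum]
    simp only [Complex.ofReal_sum, Complex.ofReal_mul, Complex.ofReal_pow, Complex.ofReal_neg,
      Complex.ofReal_one, Complex.ofReal_natCast]
    apply Finset.sum_congr rfl
    intro j _
    obtain ⟨c, h1, h2⟩ := shift_pow hS hpos (k + (m - j)) n
    have e : k + (n + (m - j)) = n + (k + (m - j)) := by omega
    rw [h1, e, ← h2, inner_smul_left, inner_smul_right, inner_stdVec, stdVec_self]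
    push_cast
    rw [Complex.conj_ofReal]
    ring
  constructor
  · intro h n
    have := key n
    unfold IsQuasiIsometric at h
    rw [h] at this
    simp only [ContinuousLinearMap.zero_apply, inner_zero_right, mul_zero] at this
    have h5 : (-1) ^ m * altD m (fun i => betaSeq lam (k + i)) n = 0 := by exact_mod_cast this.symm
    simpa using h5
  · intro h
    apply op_zero_of
    intro a b
    by_cases hab : a = b
    · subst hab
      have := key a
      rw [h a, mul_zero, Complex.ofReal_zero] at this
      have hb : (betaSeq lam a : ℂ) ≠ 0 := by
        exact_mod_cast (betaSeq_pos (fun n _ _ => hpos n)).ne'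
      exact (mul_eq_zero.mp this).resolve_left hb
    · rw [inner_quasi]
      apply Finset.sum_eq_zero
      intro j _
      obtain ⟨c, h1, -⟩ := shift_pow hS hpos (k + (m - j)) a
      obtain ⟨d, h2, -⟩ := shift_pow hS hpos (k + (m - j)) b
      rw [h1, h2, inner_smul_left, inner_smul_right, inner_stdVec, stdVec_ne (by omega)]
      simp

/-- the shifted sequence -/
def shiftFun (lam : ℕ → ℝ) (f : ℕ → ℂ) : ℕ → ℂ
  | 0 => 0
  | n + 1 => (lam (n + 1) : ℂ) * f n

lemma exists_shift {lam : ℕ → ℝ} (hpos : ∀ n, 0 < lam n) {C : ℝ} (hC : ∀ n, lam n ≤ C) :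
    ∃ S : ellTwo →L[ℂ] ellTwo, IsWeightedShift lam S := by
  have hC0 : 0 ≤ C := (hpos 0).le.trans (hC 0)
  have hp : 0 < (2 : ENNReal).toReal := by simp
  have hbd : ∀ (f : ellTwo) (n : ℕ), ‖shiftFun lam f (n + 1)‖ ^ (2 : ENNReal).toReal ≤
      C ^ (2 : ENNReal).toReal * ‖f n‖ ^ (2 : ENNReal).toReal := by
    intro f n
    rw [← Real.mul_rpow hC0 (norm_nonneg _)]
    apply Real.rpow_le_rpow (norm_nonneg _) _ hp.le
    simp only [shiftFun, norm_mul, Complex.norm_real, Real.norm_eq_abs, abs_of_pos (hpos _)]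
    exact mul_le_mul_of_nonneg_right (hC _) (norm_nonneg _)
  have hs0 : ∀ f : ellTwo, Summable fun n =>
      C ^ (2 : ENNReal).toReal * ‖f n‖ ^ (2 : ENNReal).toReal := fun f =>
    ((lp.memℓp f).summable hp).mul_left _
  have hs1 : ∀ f : ellTwo, Summable fun n => ‖shiftFun lam f (n + 1)‖ ^ (2 : ENNReal).toReal :=
    fun f => Summable.of_nonneg_of_le (fun n => by positivity) (hbd f) (hs0 f)
  have hs2 : ∀ f : ellTwo, Summable fun n => ‖shiftFun lam f n‖ ^ (2 : ENNReal).toReal :=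
    fun f => (summable_nat_add_iff 1).mp (hs1 f)
  let L : ellTwo →ₗ[ℂ] ellTwo :=
    { toFun := fun f => ⟨shiftFun lam f, memℓp_gen (hs2 f)⟩
      map_add' := by
        intro f g
        ext n
        cases n with
        | zero => exact (add_zero (0 : ℂ)).symm
        | succ n => exact mul_add (lam (n + 1) : ℂ) (f n) (g n)
      map_smul' := by
        intro c f
        ext n
        cases n with
        | zero => simp [shiftFun]
        | succ n => simp [shiftFun]; ring }
  have hL : ∀ f : ellTwo, ‖L f‖ ≤ C * ‖f‖ := by
    intro f
    apply lp.norm_le_of_tsum_le hp (mul_nonneg hC0 (norm_nonneg _))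
    rw [Real.mul_rpow hC0 (norm_nonneg _), lp.norm_rpow_eq_tsum hp, ← tsum_mul_left]
    change ∑' n, ‖shiftFun lam f n‖ ^ (2 : ENNReal).toReal ≤ _
    rw [(hs2 f).tsum_eq_zero_add]
    have : ‖shiftFun lam f 0‖ ^ (2 : ENNReal).toReal = 0 := by simp [shiftFun]
    rw [this, zero_add]
    exact (hs1 f).tsum_le_tsum (hbd f) (hs0 f)
  refine ⟨L.mkContinuous C hL, ?_⟩
  intro n
  ext i
  change shiftFun lam (stdVec n) i = (lam (n + 1) : ℂ) * stdVec (n + 1) i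
  cases i with
  | zero => rw [stdVec_ne (by omega)]; simp [shiftFun]
  | succ i =>
    by_cases h : n = i
    · subst h; simp [shiftFun, stdVec_self]
    · rw [stdVec_ne (by omega)]; simp [shiftFun, stdVec_ne h]

lemma ratio_bdd {w : Polynomial ℝ} (hw : w ≠ 0) :
    ∃ C : ℝ, ∀ n : ℕ, w.eval ((n : ℝ) + 1) / w.eval (n : ℝ) ≤ C := by
  have hdeg : (w.comp (Polynomial.X + Polynomial.C 1)).degree = w.degree := by
    have h0 : w.comp (Polynomial.X + Polynomial.C 1) ≠ 0 := by
      rw [Ne, Polynomial.comp_X_add_C_eq_zero_iff]; exact hw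
    rw [Polynomial.degree_eq_natDegree h0, Polynomial.degree_eq_natDegree hw,
      Polynomial.natDegree_comp, Polynomial.natDegree_X_add_C, mul_one]
  have h := Polynomial.div_tendsto_atTop_leadingCoeff_div_of_degree_eq _ _ hdeg
  have h2 := h.comp (tendsto_natCast_atTop_atTop (R := ℝ))
  obtain ⟨C, hC⟩ := h2.bddAbove_range
  refine ⟨C, fun n => ?_⟩
  have := hC ⟨n, rfl⟩
  simpa using this

lemma exists_completion {m k l : ℕ} (hm : 1 ≤ m) (hl : k + m ≤ l + 1)
    {lam : ℕ → ℝ} (hpos : ∀ n : ℕ, 1 ≤ n → n ≤ l → 0 < lam n)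
    (ha : ∀ n : ℕ, n + m ≤ l - k → altD m (fun i => betaSeq lam (k + i)) n = 0)
    {w : Polynomial ℝ} (hw : w.natDegree ≤ m - 1)
    (hw1 : ∀ n : ℕ, n ≤ m - 1 → w.eval (n : ℝ) = betaSeq lam (k + n))
    (hw2 : ∀ n : ℕ, m ≤ n → 0 < w.eval (n : ℝ)) :
    ∃ lam' : ℕ → ℝ, ∃ S : ellTwo →L[ℂ] ellTwo,
        IsWeightCompletion l lam lam' ∧ IsWeightedShift lam' S ∧
        ∀ n : ℕ, betaSeq lam' (k + n) = w.eval (n : ℝ) := by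
  have hag : ∀ n, n ≤ l - k → betaSeq lam (k + n) = w.eval (n : ℝ) :=
    agree_of_altD (f := fun i => betaSeq lam (k + i)) (g := fun i => w.eval (i : ℝ))
      (fun n hn => (hw1 n (by omega)).symm) ha (fun n _ => altD_poly_zero (by omega) n)
  have hwpos : ∀ n : ℕ, 0 < w.eval (n : ℝ) := by
    intro n
    by_cases h : m ≤ n
    · exact hw2 n h
    · rw [hw1 n (by omega)]
      exact betaSeq_pos (fun i h1 h2 => hpos i h1 (by omega))
  have hw0 : w ≠ 0 := by
    rintro rfl
    simpa using hwpos 0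
  let lam' : ℕ → ℝ := fun n => if n = 0 then 1 else if n ≤ l then lam n else
    Real.sqrt (w.eval ((n - k : ℕ) : ℝ) / w.eval ((n - 1 - k : ℕ) : ℝ))
  have hlam'1 : ∀ n, 1 ≤ n → n ≤ l → lam' n = lam n := by
    intro n h1 h2
    have : n ≠ 0 := by omega
    simp [lam', this, h2]
  have hlam'2 : ∀ n, l < n → lam' n =
      Real.sqrt (w.eval ((n - k : ℕ) : ℝ) / w.eval ((n - 1 - k : ℕ) : ℝ)) := by
    intro n h1
    have h2 : n ≠ 0 := by omega
    have h3 : ¬ n ≤ l := by omega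
    simp [lam', h2, h3]
  have hp : ∀ n, 0 < lam' n := by
    intro n
    rcases Nat.eq_zero_or_pos n with h | h
    · simp [lam', h]
    · by_cases h2 : n ≤ l
      · rw [hlam'1 n h h2]; exact hpos n h h2
      · rw [hlam'2 n (by omega)]
        exact Real.sqrt_pos.mpr (div_pos (hwpos _) (hwpos _))
  have hb : ∃ C : ℝ, ∀ n, lam' n ≤ C := by
    obtain ⟨C, hC⟩ := ratio_bdd hw0
    refine ⟨Real.sqrt C + ∑ i ∈ Finset.range (l + 1), lam' i, fun n => ?_⟩
    by_cases h : n ≤ l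
    · have h1 := Finset.single_le_sum (f := lam') (s := Finset.range (l + 1))
        (fun i _ => (hp i).le) (Finset.mem_range.mpr (by omega : n < l + 1))
      have := Real.sqrt_nonneg C
      linarith
    · rw [hlam'2 n (by omega)]
      have h1 : 0 ≤ ∑ i ∈ Finset.range (l + 1), lam' i :=
        Finset.sum_nonneg (fun i _ => (hp i).le)
      have h2 : Real.sqrt (w.eval ((n - k : ℕ) : ℝ) / w.eval ((n - 1 - k : ℕ) : ℝ))
          ≤ Real.sqrt C := by
        apply Real.sqrt_le_sqrt
        have h3 := hC (n - 1 - k)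
        have e : ((n - k : ℕ) : ℝ) = ((n - 1 - k : ℕ) : ℝ) + 1 := by
          rw [show n - k = n - 1 - k + 1 by omega]; push_cast; rfl
        rw [e]; exact h3
      linarith
  obtain ⟨C, hC⟩ := hb
  obtain ⟨S, hS⟩ := exists_shift hp hC
  refine ⟨lam', S, ⟨hp, ⟨C, hC⟩, hlam'1⟩, hS, ?_⟩
  intro n
  induction n with
  | zero =>
    rw [betaSeq_congr (fun i h1 h2 => hlam'1 i h1 (by omega))]
    exact hag 0 (by omega)
  | succ n ih =>
    by_cases h : k + (n + 1) ≤ l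
    · rw [betaSeq_congr (fun i h1 h2 => hlam'1 i h1 (by omega))]
      exact hag (n + 1) (by omega)
    · rw [← add_assoc, betaSeq_succ, ih, hlam'2 _ (by omega),
        Real.sq_sqrt (div_pos (hwpos _) (hwpos _)).le]
      rw [show k + n + 1 - k = n + 1 by omega, show k + n + 1 - 1 - k = n by omega]
      field_simp [(hwpos n).ne']

lemma cond_iff {m k l : ℕ} {lam : ℕ → ℝ} (hl : k ≤ l) :
    (∀ n : ℕ, (n : ℤ) ≤ (l : ℤ) - (k + m : ℤ) →
          ∑ j ∈ Finset.range (m + 1),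
            (-1 : ℝ) ^ j * (m.choose j : ℝ) * betaSeq lam (k + n + j) = 0) ↔
    ∀ n : ℕ, n + m ≤ l - k → altD m (fun i => betaSeq lam (k + i)) n = 0 := by
  simp only [altD, ← add_assoc]
  constructor
  · intro h n hn
    exact h n (by omega)
  · intro h n hn
    exact h n (by omega)

lemma forward {m k l : ℕ} (hm : 1 ≤ m) (hl : k + m ≤ l + 1) {lam lam' : ℕ → ℝ}
    {S : ellTwo →L[ℂ] ellTwo}
    (hc : IsWeightCompletion l lam lam') (hS : IsWeightedShift lam' S)
    (hq : IsQuasiIsometric k m S) :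
    (∀ n : ℕ, n + m ≤ l - k → altD m (fun i => betaSeq lam (k + i)) n = 0) ∧
    ∀ w : Polynomial ℝ, w.natDegree ≤ m - 1 →
      (∀ n : ℕ, n ≤ m - 1 → w.eval (n : ℝ) = betaSeq lam (k + n)) →
      ∀ n : ℕ, betaSeq lam' (k + n) = w.eval (n : ℝ) := by
  rw [quasi_iff hS hc.1] at hq
  constructor
  · intro n hn
    rw [← hq n]
    unfold altD
    apply Finset.sum_congr rfl
    intro j hj
    have := Finset.mem_range.mp hj
    beta_reduce
    rw [betaSeq_congr (fun i h1 h2 => (hc.2.2 i h1 (by omega)))]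
  · intro w hw hw1 n
    refine agree_of_altD (m := m) (N := n + m) (f := fun i => betaSeq lam' (k + i))
      (g := fun i => w.eval (i : ℝ)) ?_ (fun n _ => hq n)
      (fun n _ => altD_poly_zero (by omega) n) n (by omega)
    intro i hi
    change betaSeq lam' (k + i) = w.eval (i : ℝ)
    rw [hw1 i (by omega), betaSeq_congr (fun i h1 h2 => (hc.2.2 i h1 (by omega)))]

/-- Proposition, part (ii).
Let `l > k + m − 2` and `λ_1, …, λ_l ∈ (0, ∞)`. A `k`-quasi-`m`-isometric completion with
initial weights `λ_1, …, λ_l` exists iff (a) the finite-difference conditions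
`Σ_{j=0}^m (−1)^j C(m,j) (βλ)_{k+n+j} = 0` hold for all `0 ≤ n ≤ l − (k+m)` and (b) the unique
polynomial `w` of degree at most `m−1` interpolating `w(n) = (βλ)_{k+n}` for `0 ≤ n ≤ m−1`
is positive at every integer `n ≥ m`.  Moreover a *strict* `k`-quasi-`m`-isometric completion
exists iff in addition the degree of `w` is exactly `m − 1`. -/
theorem stmt2 (m k l : ℕ) (hm : 1 ≤ m) (hk : 1 ≤ k) (hl : k + m - 2 < l)
    (lam : ℕ → ℝ) (hpos : ∀ n : ℕ, 1 ≤ n → n ≤ l → 0 < lam n) :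
    ((∃ lam' : ℕ → ℝ, ∃ S : ellTwo →L[ℂ] ellTwo,
        IsWeightCompletion l lam lam' ∧ IsWeightedShift lam' S ∧ IsQuasiIsometric k m S) ↔
      ((∀ n : ℕ, (n : ℤ) ≤ (l : ℤ) - (k + m : ℤ) →
          ∑ j ∈ Finset.range (m + 1),
            (-1 : ℝ) ^ j * (m.choose j : ℝ) * betaSeq lam (k + n + j) = 0) ∧
        (∀ w : Polynomial ℝ, w.natDegree ≤ m - 1 →
          (∀ n : ℕ, n ≤ m - 1 → w.eval (n : ℝ) = betaSeq lam (k + n)) →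
          ∀ n : ℕ, m ≤ n → 0 < w.eval (n : ℝ))))
    ∧
    ((∃ lam' : ℕ → ℝ, ∃ S : ellTwo →L[ℂ] ellTwo,
        IsWeightCompletion l lam lam' ∧ IsWeightedShift lam' S ∧
          IsQuasiIsometric k m S ∧ ¬ IsQuasiIsometric k (m - 1) S) ↔
      ((∀ n : ℕ, (n : ℤ) ≤ (l : ℤ) - (k + m : ℤ) →
          ∑ j ∈ Finset.range (m + 1),
            (-1 : ℝ) ^ j * (m.choose j : ℝ) * betaSeq lam (k + n + j) = 0) ∧
        (∃ w : Polynomial ℝ, w.natDegree = m - 1 ∧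
          (∀ n : ℕ, n ≤ m - 1 → w.eval (n : ℝ) = betaSeq lam (k + n)) ∧
          ∀ n : ℕ, m ≤ n → 0 < w.eval (n : ℝ)))) := by
  have hl' : k + m ≤ l + 1 := by omega
  have hkl : k ≤ l := by omega
  rw [cond_iff hkl]
  constructor
  · constructor
    · rintro ⟨lam', S, hc, hS, hq⟩
      obtain ⟨h1, h2⟩ := forward hm hl' hc hS hq
      refine ⟨h1, fun w hw hw1 n _ => ?_⟩
      rw [← h2 w hw hw1 n]
      exact betaSeq_pos (fun i _ _ => hc.1 i)
    · rintro ⟨ha, hb⟩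
      obtain ⟨w, hw, hw1⟩ := exists_interp hm (fun i => betaSeq lam (k + i))
      obtain ⟨lam', S, hc, hS, hbeta⟩ :=
        exists_completion hm hl' hpos ha hw hw1 (hb w hw hw1)
      refine ⟨lam', S, hc, hS, ?_⟩
      rw [quasi_iff hS hc.1]
      simp only [hbeta]
      exact altD_poly_zero (by omega)
  · constructor
    · rintro ⟨lam', S, hc, hS, hq, hnq⟩
      obtain ⟨h1, h2⟩ := forward hm hl' hc hS hq
      obtain ⟨w, hw, hw1⟩ := exists_interp hm (fun i => betaSeq lam (k + i))
      have hbeta := h2 w hw hw1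
      refine ⟨h1, w, ?_, hw1, ?_⟩
      · by_contra hne
        apply hnq
        rw [quasi_iff hS hc.1]
        simp only [hbeta]
        exact altD_poly_zero (by omega)
      · intro n _
        rw [← hbeta n]
        exact betaSeq_pos (fun i _ _ => hc.1 i)
    · rintro ⟨ha, w, hw, hw1, hw2⟩
      obtain ⟨lam', S, hc, hS, hbeta⟩ :=
        exists_completion hm hl' hpos ha hw.le hw1 hw2
      refine ⟨lam', S, hc, hS, ?_, ?_⟩
      · rw [quasi_iff hS hc.1]
        simp only [hbeta]
        exact altD_poly_zero (by omega)
      · rw [quasi_iff hS hc.1]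
        simp only [hbeta]
        intro h
        rw [← hw] at h
        refine altD_poly_ne ?_ 0 (h 0)
        rintro rfl
        simpa using hw2 m le_rfl
end
end

section
/- Let m, κ, k be integers with κ > m ≥ 2 and k ≥ 1, and let X, φ be the one-circuit directed-graph space with circuit length κ and branch counts η_1, …, η_κ. Let M ∈ (0, ∞), for each r ∈ {1,…,κ} and each i with 1 ≤ i ≤ η_r let w^r_i be a real polynomial of degree at most m−2, and let a^r_{i,j} ∈ (0, ∞) (j ≥ 1) satisfy w^r_i(j) = a^r_{i,k+j} for all r, i and all j ≥ 1, together with the bound max_{r∈{1,…,κ}} { Σ_{i=1}^{η_r} a^r_{i,1}, sup{ a^r_{i,j+1} / a^r_{i,j} : 1 ≤ i ≤ η_r, j ≥ 1 } } ≤ M. Then there exists a measure μ on X such that (1) μ({x^r_{i,j}}) = a^r_{i,j} for all r, i and j ≥ 1, and (2) the composition operator C_φ is bounded on L²(μ) and k-quasi-m-isometric. Furthermore, there exists c ∈ ℝ such that for every t ∈ (c, ∞) there is a measure μ_t with the same two properties, given by μ_t({x_r}) = μ({x_r}) + t for r ∈ {1,…,κ} and μ_t({x}) = μ({x}) for every branch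 point x. -/
open MeasureTheory
noncomputable section

/-- Index type of the branches emanating from the circuit vertex `r`:
integers `i` with `1 ≤ i ≤ η r` (where `η r ∈ ℕ ∪ {∞}` is the number of branches at `r`). -/
def Br (κ : ℕ) (η : ZMod κ → ℕ∞) (r : ZMod κ) : Type :=
  {i : ℕ // 1 ≤ i ∧ (i : ℕ∞) ≤ η r}

/-- The one-circuit directed-graph space: circuit points `x_r` (`r ∈ ZMod κ`) together with
branch points `x^r_{i,j}` for `r ∈ ZMod κ`, `1 ≤ i ≤ η r`, `j ≥ 1`. -/
def GraphX (κ : ℕ) (η : ZMod κ → ℕ∞) : Type :=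
  ZMod κ ⊕ (Σ r : ZMod κ, Br κ η r × ℕ+)

instance (κ : ℕ) (η : ZMod κ → ℕ∞) : MeasurableSpace (GraphX κ η) := ⊤

/-- The circuit point `x_r`. -/
def cpt {κ : ℕ} {η : ZMod κ → ℕ∞} (r : ZMod κ) : GraphX κ η := Sum.inl r

/-- The branch point `x^r_{i,j}`. -/
def bpt {κ : ℕ} {η : ZMod κ → ℕ∞} (r : ZMod κ) (i : Br κ η r) (j : ℕ+) : GraphX κ η :=
  Sum.inr ⟨r, i, j⟩

/-- The parent map `φ`: `φ(x^r_{i,j+1}) = x^r_{i,j}`, `φ(x^r_{i,1}) = x_r`,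
`φ(x_r) = x_{r−1}` (indices mod `κ`). -/
def parent {κ : ℕ} {η : ZMod κ → ℕ∞} : GraphX κ η → GraphX κ η
  | Sum.inl r => Sum.inl (r - 1)
  | Sum.inr ⟨r, i, j⟩ => if j = 1 then Sum.inl r else Sum.inr ⟨r, i, j - 1⟩

variable {E : Type*} [NormedAddCommGroup E] [InnerProductSpace ℂ E] [CompleteSpace E]

/-- The composition operator `C_φ f = f ∘ φ` induced by the parent map is a bounded
operator on `L²(μ)` which is `k`-quasi-`m`-isometric. -/
def CompBoundedQuasi (κ : ℕ) (η : ZMod κ → ℕ∞) (μ : Measure (GraphX κ η)) (k m : ℕ) : Prop :=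
  ∃ T : Lp ℂ 2 μ →L[ℂ] Lp ℂ 2 μ,
    (∀ f : Lp ℂ 2 μ,
      (T f : GraphX κ η → ℂ) =ᵐ[μ] fun x => (f : GraphX κ η → ℂ) (parent x)) ∧
    IsQuasiIsometric k m T


lemma generic_op {α : Type} [MeasurableSpace α] [DiscreteMeasurableSpace α] [Countable α]
    (φ : α → α) (μ : Measure α) (C : NNReal) (hpos : ∀ x, 0 < μ {x})
    (hle : ∀ x, μ (φ ⁻¹' {x}) ≤ C * μ {x}) (k m : ℕ)
    (hd : ∀ x, (fwdDiff 1)^[m] (fun p : ℕ => μ.real (φ^[p] ⁻¹' {x})) k = 0) :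
    ∃ T : Lp ℂ 2 μ →L[ℂ] Lp ℂ 2 μ,
    (∀ f : Lp ℂ 2 μ,
      (T f : α → ℂ) =ᵐ[μ] fun x => (f : α → ℂ) (φ x)) ∧
    IsQuasiIsometric k m T := by
  have hφ : Measurable φ := measurable_of_countable φ
  have hae : ∀ {p : α → Prop}, (∀ᵐ x ∂μ, p x) → ∀ x, p x := by
    intro p hp x
    by_contra hx
    have h1 : μ {x | ¬ p x} = 0 := hp
    have h2 : μ {x} ≤ μ {x | ¬ p x} := measure_mono (by simpa using hx)
    exact absurd (hpos x) (by rw [h1] at h2; simpa using h2)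
  have hmap : μ.map φ ≤ (C : ENNReal) • μ := by
    refine Measure.le_iff.2 fun s hs => ?_
    rw [Measure.smul_apply, ← Measure.tsum_indicator_apply_singleton (μ.map φ) s hs,
      ← Measure.tsum_indicator_apply_singleton μ s hs, smul_eq_mul, ← ENNReal.tsum_mul_left]
    refine ENNReal.tsum_le_tsum fun x => ?_
    by_cases hx : x ∈ s
    · simpa [hx, Measure.map_apply hφ (measurableSet_singleton x)] using hle x
    · simp [hx]
  have hmem : ∀ f : Lp ℂ 2 μ, MemLp ((f : α → ℂ) ∘ φ) 2 μ := fun f =>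
    ((Lp.memLp f).of_measure_le_smul ENNReal.coe_ne_top hmap).comp_of_map hφ.aemeasurable
  have hcoe : ∀ f : Lp ℂ 2 μ, ∀ x, ((hmem f).toLp : α → ℂ) x = f (φ x) := fun f =>
    hae (hmem f).coeFn_toLp
  let L : Lp ℂ 2 μ →ₗ[ℂ] Lp ℂ 2 μ :=
    { toFun := fun f => (hmem f).toLp
      map_add' := fun f g => by
        apply Lp.ext
        refine Filter.Eventually.of_forall fun x => ?_
        rw [hcoe, hae (Lp.coeFn_add f g), hae (Lp.coeFn_add _ _)]
        simp [hcoe]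
      map_smul' := fun c f => by
        apply Lp.ext
        refine Filter.Eventually.of_forall fun x => ?_
        rw [hcoe, hae (Lp.coeFn_smul c f), hae (Lp.coeFn_smul _ _)]
        simp [hcoe] }
  let T : Lp ℂ 2 μ →L[ℂ] Lp ℂ 2 μ := L.mkContinuous (((C : ENNReal) ^ (1 / 2 : ENNReal).toReal).toReal) (by
    intro f
    change ‖(hmem f).toLp‖ ≤ _
    rw [Lp.norm_toLp, Lp.norm_def, ← ENNReal.toReal_mul]
    apply ENNReal.toReal_mono
    · exact ENNReal.mul_ne_top (ENNReal.rpow_ne_top_of_nonneg (by simp) ENNReal.coe_ne_top) (Lp.eLpNorm_ne_top f)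
    · rw [← eLpNorm_map_measure ((Lp.aestronglyMeasurable f).mono_ac
        (Measure.absolutelyContinuous_of_le_smul hmap)) hφ.aemeasurable, ← smul_eq_mul,
        ← eLpNorm_smul_measure_of_ne_top (by simp)]
      exact eLpNorm_mono_measure _ hmap)
  have hT : ∀ f : Lp ℂ 2 μ, ∀ x, (T f : α → ℂ) x = f (φ x) := hcoe
  refine ⟨T, fun f => Filter.Eventually.of_forall (hT f), ?_⟩
  have hTp : ∀ p : ℕ, ∀ f : Lp ℂ 2 μ, ∀ x, ((T ^ p) f : α → ℂ) x = f (φ^[p] x) := by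
    intro p
    induction p with
    | zero => intro f x; simp
    | succ p ih =>
      intro f x
      rw [pow_succ, mul_apply_eq_comp, ih, hT, Function.iterate_succ_apply']
  -- inner products
  have hin : ∀ (f g : Lp ℂ 2 μ) (p : ℕ), HasSum (fun x => (μ.real (φ^[p] ⁻¹' {x}) : ℂ) *
      inner ℂ (f x) (g x)) (inner ℂ ((T ^ p) f) ((T ^ p) g)) := by
    intro f g p
    rw [L2.inner_def]
    have hi := L2.integrable_inner (𝕜 := ℂ) ((T ^ p) f) ((T ^ p) g)
    have := hasSum_integral_iUnion (μ := μ) (s := fun x : α => φ^[p] ⁻¹' {x})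
      (fun x => MeasurableSet.of_discrete)
      (fun x y hxy => Set.disjoint_left.2 fun z hz hz' => hxy (by
        simp only [Set.mem_preimage, Set.mem_singleton_iff] at hz hz'; rw [← hz, ← hz']))
      hi.integrableOn
    have hU : (⋃ x : α, φ^[p] ⁻¹' {x}) = Set.univ := by
      ext z; simp
    rw [hU, setIntegral_univ] at this
    refine (funext fun x => ?_ : (fun x => (μ.real (φ^[p] ⁻¹' {x}) : ℂ) * inner ℂ (f x) (g x)) = _) ▸ this
    rw [setIntegral_congr_fun (g := fun _ => inner ℂ (f x) (g x)) MeasurableSet.of_discrete]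
    · rw [setIntegral_const]; simp
    · intro z hz
      simp only [Set.mem_preimage, Set.mem_singleton_iff] at hz
      simp only [hTp, hz]
  have hadj : ∀ (p : ℕ) (f g : Lp ℂ 2 μ), inner ℂ ((ContinuousLinearMap.adjoint T ^ p) f) g =
      inner ℂ f ((T ^ p) g) := by
    intro p
    induction p with
    | zero => intro f g; simp
    | succ p ih =>
      intro f g
      rw [pow_succ, mul_apply_eq_comp, ih, ContinuousLinearMap.adjoint_inner_left,
        pow_succ', mul_apply_eq_comp]
  unfold IsQuasiIsometric
  ext1 f
  refine ext_inner_right ℂ fun g => ?_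
  have key : inner ℂ ((ContinuousLinearMap.adjoint T ^ k * Bop m T * T ^ k) f) g =
      ∑ j ∈ Finset.range (m + 1), ((-1 : ℂ) ^ j * (m.choose j : ℂ)) *
        inner ℂ ((T ^ (m - j + k)) f) ((T ^ (m - j + k)) g) := by
    rw [mul_apply_eq_comp, mul_apply_eq_comp, hadj, Bop,
      _root_.sum_apply, sum_inner]
    refine Finset.sum_congr rfl fun j _ => ?_
    rw [_root_.smul_apply, inner_smul_left, mul_apply_eq_comp, hadj,
      pow_add, mul_apply_eq_comp, mul_apply_eq_comp]
    simp
  rw [key, _root_.zero_apply, inner_zero_left]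
  have hs := hasSum_sum (s := Finset.range (m + 1)) fun j _ =>
    (hin f g (m - j + k)).mul_left ((-1 : ℂ) ^ j * (m.choose j : ℂ))
  refine hs.unique ?_
  convert hasSum_zero with x
  have hx := hd x
  rw [fwdDiff_iter_eq_sum_shift] at hx
  simp only [zsmul_eq_mul, smul_eq_mul, mul_one] at hx
  rw [← Finset.sum_range_reflect] at hx
  have hx' := congrArg (fun r : ℝ => (r : ℂ) * inner ℂ (f x) (g x)) hx
  simp only [Complex.ofReal_zero, zero_mul] at hx'
  rw [← hx', Complex.ofReal_sum, Finset.sum_mul]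
  refine Finset.sum_congr rfl fun j hj => ?_
  have hj' : j ≤ m := by simpa [Nat.lt_succ_iff] using hj
  have e1 : m + 1 - 1 - j = m - j := by omega
  have e2 : m - (m - j) = j := by omega
  rw [e1, e2, Nat.choose_symm hj', add_comm k (m - j)]
  push_cast
  ring

lemma polyDiff (P : Polynomial ℝ) (n : ℕ) (hP : P.natDegree < n) (f : ℕ → ℝ) (y : ℕ) (x : ℝ)
    (h : ∀ l : ℕ, f (y + l) = P.eval (x + l)) : (fwdDiff 1)^[n] f y = 0 := by
  have := congrFun (Polynomial.fwdDiff_iter_eq_zero_of_degree_lt hP) x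
  rw [fwdDiff_iter_eq_sum_shift] at this ⊢
  simpa [h] using this

lemma one_step {κ : ℕ} [NeZero κ] (d : ZMod κ → ℝ) (hd : ∑ r, d r = 0) :
    ∃ c : ZMod κ → ℝ, ∑ r, c r = 0 ∧ fwdDiff 1 c = d := by
  let S : (ZMod κ → ℝ) →ₗ[ℝ] ℝ := ∑ r, LinearMap.proj r
  have hS : ∀ f, S f = ∑ r, f r := fun f => by simp [S]
  let D : (ZMod κ → ℝ) →ₗ[ℝ] (ZMod κ → ℝ) := LinearMap.funLeft ℝ ℝ (fun r => r + 1) - 1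
  have hD : ∀ f r, D f r = f (r + 1) - f r := fun f r => by simp [D, LinearMap.funLeft]
  have hmaps : ∀ f ∈ LinearMap.ker S, D f ∈ LinearMap.ker S := by
    intro f _
    rw [LinearMap.mem_ker, hS]
    simp only [hD, Finset.sum_sub_distrib]
    rw [sub_eq_zero]
    exact Equiv.sum_comp (Equiv.addRight (1 : ZMod κ)) f
  have hinj : Function.Injective (D.restrict hmaps) := by
    rw [← LinearMap.ker_eq_bot, LinearMap.ker_eq_bot']
    rintro ⟨f, hf⟩ h
    have h1 : ∀ r, f (r + 1) = f r := fun r => by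
      have := congrFun (congrArg Subtype.val h) r
      simp only [LinearMap.coe_restrict_apply, hD] at this
      simpa [sub_eq_zero] using this
    have h2 : ∀ n : ℕ, f (n : ZMod κ) = f 0 := by
      intro n
      induction n with
      | zero => simp
      | succ n ih => rw [Nat.cast_succ, h1, ih]
    have h3 : ∀ r, f r = f 0 := fun r => by
      obtain ⟨n, rfl⟩ := ZMod.natCast_zmod_surjective r
      exact h2 n
    rw [LinearMap.mem_ker, hS] at hf
    simp only [h3, Finset.sum_const, Finset.card_univ, ZMod.card] at hf
    have h0 : f 0 = 0 := by simpa [NeZero.ne κ] using hf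
    ext r
    simp [h3 r, h0]
  have hsurj := LinearMap.injective_iff_surjective.1 hinj
  obtain ⟨⟨c, hc⟩, h⟩ := hsurj ⟨d, by rw [LinearMap.mem_ker, hS, hd]⟩
  refine ⟨c, by rw [← hS]; exact hc, ?_⟩
  funext r
  have := congrFun (congrArg Subtype.val h) r
  simp only [LinearMap.coe_restrict_apply, hD] at this
  simpa [fwdDiff] using this

lemma many_step {κ : ℕ} [NeZero κ] (m : ℕ) (d : ZMod κ → ℝ) (hd : ∑ r, d r = 0) :
    ∃ c : ZMod κ → ℝ, ∑ r, c r = 0 ∧ (fwdDiff 1)^[m] c = d := by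
  induction m generalizing d with
  | zero => exact ⟨d, hd, rfl⟩
  | succ m ih =>
    obtain ⟨e, he, he'⟩ := ih d hd
    obtain ⟨c, hc, hc'⟩ := one_step e he
    exact ⟨c, hc, by rw [Function.iterate_succ_apply, hc', he']⟩

def nseq {κ : ℕ} (A : ZMod κ → ℕ → ℝ) (b : ZMod κ → ℝ) : ℕ → ZMod κ → ℝ
  | 0 => b
  | p + 1 => fun r => nseq A b p (r + 1) + A r (p + 1)

lemma nseq_split {κ : ℕ} (A : ZMod κ → ℕ → ℝ) (b b' : ZMod κ → ℝ) (p : ℕ) :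
    ∀ r, nseq A (fun r => b r + b' r) p r = b (r + p) + nseq A b' p r := by
  induction p with
  | zero => intro r; simp [nseq]
  | succ p ih =>
    intro r
    simp only [nseq]
    rw [ih]
    have : r + 1 + (p : ZMod κ) = r + ((p + 1 : ℕ) : ZMod κ) := by push_cast; ring
    rw [this]; ring

lemma diff_split {κ : ℕ} (A : ZMod κ → ℕ → ℝ) (b b' : ZMod κ → ℝ) (m k : ℕ) (r : ZMod κ) :
    (fwdDiff 1)^[m] (fun p => nseq A (fun r => b r + b' r) p r) k =
      (fwdDiff 1)^[m] b (r + k) + (fwdDiff 1)^[m] (fun p => nseq A b' p r) k := by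
  simp only [nseq_split]
  simp only [fwdDiff_iter_eq_sum_shift, smul_add, Finset.sum_add_distrib]
  congr 1
  refine Finset.sum_congr rfl fun j _ => ?_
  simp [add_assoc]

lemma solver {κ : ℕ} [NeZero κ] (A : ZMod κ → ℕ → ℝ) (m k : ℕ)
    (hA : (fwdDiff 1)^[m] (fun p => ∑ r, A r (p + 1)) k = 0) :
    ∃ b : ZMod κ → ℝ, ∀ r, (fwdDiff 1)^[m + 1] (fun p => nseq A b p r) k = 0 := by
  set D : ZMod κ → ℝ := fun r => (fwdDiff 1)^[m + 1] (fun p => nseq A (fun _ => 0) p r) k with hD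
  have hDs : ∑ r, D r = 0 := by
    have h1 : ∑ r, D r = (fwdDiff 1)^[m + 1] (fun p => ∑ r, nseq A (fun _ => 0) p r) k := by
      simp only [hD, fwdDiff_iter_eq_sum_shift, Finset.smul_sum]
      rw [Finset.sum_comm]
    rw [h1, Function.iterate_succ_apply]
    refine Eq.trans (congrFun (congrArg _ (funext fun p => ?_)) k) hA
    simp only [fwdDiff, nseq, Finset.sum_add_distrib]
    have := Equiv.sum_comp (Equiv.addRight (1 : ZMod κ)) (nseq A (fun _ => 0) p)
    simp only [Equiv.coe_addRight] at this
    rw [this]; ring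
  obtain ⟨c, -, hc⟩ := many_step (m + 1) (fun r : ZMod κ => - D (r - (k : ZMod κ))) (by
    rw [Finset.sum_neg_distrib, neg_eq_zero, ← hDs]
    exact Equiv.sum_comp (Equiv.subRight (k : ZMod κ)) D)
  refine ⟨fun r => c r + 0, fun r => ?_⟩
  rw [diff_split A c (fun _ => 0), hc]
  simp [hD]

lemma diff_const_add {κ : ℕ} (A : ZMod κ → ℕ → ℝ) (b : ZMod κ → ℝ) (t : ℝ) (m k : ℕ) (r : ZMod κ) :
    (fwdDiff 1)^[m + 1] (fun p => nseq A (fun r => t + b r) p r) k =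
      (fwdDiff 1)^[m + 1] (fun p => nseq A b p r) k := by
  rw [diff_split A (fun _ => t) b, Function.iterate_succ_apply, fwdDiff_const]
  have : ∀ n : ℕ, (fwdDiff (1 : ZMod κ))^[n] (fun _ : ZMod κ => (0 : ℝ)) = fun _ => 0 := by
    intro n
    induction n with
    | zero => rfl
    | succ n ih => rw [Function.iterate_succ_apply, fwdDiff_const, ih]
  rw [this, zero_add]

instance (κ : ℕ) (η : ZMod κ → ℕ∞) : DiscreteMeasurableSpace (GraphX κ η) := ⟨fun _ => trivial⟩

instance (κ : ℕ) (η : ZMod κ → ℕ∞) (r : ZMod κ) : Countable (Br κ η r) :=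
  inferInstanceAs (Countable {i : ℕ // 1 ≤ i ∧ (i : ℕ∞) ≤ η r})

instance (κ : ℕ) [NeZero κ] (η : ZMod κ → ℕ∞) : Countable (GraphX κ η) :=
  inferInstanceAs (Countable (ZMod κ ⊕ (Σ r : ZMod κ, Br κ η r × ℕ+)))

lemma pt_cases {κ : ℕ} {η : ZMod κ → ℕ∞} (x : GraphX κ η) :
    (∃ r, x = cpt r) ∨ ∃ r i j, x = bpt r i j := by
  rcases x with r | ⟨r, i, j⟩
  · exact Or.inl ⟨r, rfl⟩
  · exact Or.inr ⟨r, i, j, rfl⟩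

lemma cpt_inj {κ : ℕ} {η : ZMod κ → ℕ∞} {r s : ZMod κ} (h : (cpt r : GraphX κ η) = cpt s) :
    r = s := Sum.inl.inj h

lemma cpt_ne {κ : ℕ} {η : ZMod κ → ℕ∞} {r s : ZMod κ} {i : Br κ η s} {j : ℕ+} :
    cpt r ≠ bpt s i j := fun h => Sum.inl_ne_inr h

lemma bpt_inj {κ : ℕ} {η : ZMod κ → ℕ∞} {r s : ZMod κ} {i : Br κ η r} {i' : Br κ η s} {j j' : ℕ+}
    (h : bpt r i j = bpt s i' j') : r = s ∧ HEq i i' ∧ j = j' := by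
  have h := Sum.inr.inj h
  rw [Sigma.mk.injEq] at h
  obtain ⟨rfl, h⟩ := h
  simp only [heq_eq_eq, Prod.mk.injEq] at h
  exact ⟨rfl, heq_of_eq h.1, h.2⟩

lemma parent_cpt {κ : ℕ} {η : ZMod κ → ℕ∞} (r : ZMod κ) :
    parent (cpt r : GraphX κ η) = cpt (r - 1) := rfl

lemma parent_bpt_one {κ : ℕ} {η : ZMod κ → ℕ∞} (r : ZMod κ) (i : Br κ η r) :
    parent (bpt r i 1) = cpt r := rfl

lemma parent_bpt_succ {κ : ℕ} {η : ZMod κ → ℕ∞} (r : ZMod κ) (i : Br κ η r) (j : ℕ+) :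
    parent (bpt r i (j + 1)) = bpt r i j := by
  have h : j + 1 ≠ 1 := fun h => by
    have := congrArg PNat.val h
    simp at this
  have h2 : j + 1 - 1 = j := by simp
  have : parent (bpt r i (j + 1)) = bpt r i (j + 1 - 1) := if_neg h
  rw [this, h2]

lemma pre_bpt {κ : ℕ} {η : ZMod κ → ℕ∞} (r : ZMod κ) (i : Br κ η r) (j : ℕ+) :
    parent ⁻¹' {bpt r i j} = {bpt r i (j + 1)} := by
  ext x
  simp only [Set.mem_preimage, Set.mem_singleton_iff]
  constructor
  · intro h
    rcases pt_cases x with ⟨s, rfl⟩ | ⟨s, i', j', rfl⟩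
    · exact absurd h cpt_ne
    · induction j' using PNat.recOn with
      | one => exact absurd h cpt_ne
      | succ j' _ =>
        rw [parent_bpt_succ] at h
        obtain ⟨rfl, h1, rfl⟩ := bpt_inj h
        rw [eq_of_heq h1]
  · rintro rfl
    exact parent_bpt_succ r i j

lemma pre_cpt {κ : ℕ} {η : ZMod κ → ℕ∞} (r : ZMod κ) :
    parent ⁻¹' {(cpt r : GraphX κ η)} = {cpt (r + 1)} ∪ ⋃ i : Br κ η r, {bpt r i 1} := by
  ext x
  simp only [Set.mem_preimage, Set.mem_singleton_iff, Set.mem_union, Set.mem_iUnion]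
  constructor
  · intro h
    rcases pt_cases x with ⟨s, rfl⟩ | ⟨s, i', j', rfl⟩
    · left
      rw [← cpt_inj h, sub_add_cancel]
    · right
      induction j' using PNat.recOn with
      | one =>
        obtain rfl := cpt_inj h
        exact ⟨i', rfl⟩
      | succ j' _ =>
        rw [parent_bpt_succ] at h
        exact absurd h.symm cpt_ne
  · rintro (rfl | ⟨i, rfl⟩)
    · rw [parent_cpt, add_sub_cancel_right]
    · rfl

def wt {κ : ℕ} {η : ZMod κ → ℕ∞} (b : ZMod κ → ℝ) (a : (r : ZMod κ) → Br κ η r → ℕ → ℝ) :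
    GraphX κ η → ℝ
  | Sum.inl r => b r
  | Sum.inr ⟨r, i, j⟩ => a r i j

def mu {κ : ℕ} {η : ZMod κ → ℕ∞} (b : ZMod κ → ℝ) (a : (r : ZMod κ) → Br κ η r → ℕ → ℝ) :
    Measure (GraphX κ η) :=
  Measure.sum fun x => ENNReal.ofReal (wt b a x) • Measure.dirac x

lemma mu_singleton {κ : ℕ} {η : ZMod κ → ℕ∞} (b : ZMod κ → ℝ)
    (a : (r : ZMod κ) → Br κ η r → ℕ → ℝ) (x : GraphX κ η) :
    mu b a {x} = ENNReal.ofReal (wt b a x) := by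
  rw [mu, Measure.sum_apply _ MeasurableSet.of_discrete, tsum_eq_single x]
  · simp
  · intro y hy
    simp [hy]

lemma mu_pre_bpt {κ : ℕ} {η : ZMod κ → ℕ∞} (b : ZMod κ → ℝ)
    (a : (r : ZMod κ) → Br κ η r → ℕ → ℝ) (p : ℕ) :
    ∀ (r : ZMod κ) (i : Br κ η r) (j : ℕ+),
    mu b a (parent^[p] ⁻¹' {bpt r i j}) = ENNReal.ofReal (a r i (j + p)) := by
  induction p with
  | zero => intro r i j; exact mu_singleton b a _
  | succ p ih =>
    intro r i j
    rw [Function.iterate_succ', Set.preimage_comp, pre_bpt, ih]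
    congr 2
    push_cast; ring

lemma mu_pre_cpt {κ : ℕ} {η : ZMod κ → ℕ∞} (b : ZMod κ → ℝ) (hb : ∀ r, 0 < b r)
    (a : (r : ZMod κ) → Br κ η r → ℕ → ℝ) (ha : ∀ r i (j : ℕ), 1 ≤ j → 0 < a r i j)
    (hs : ∀ r (j : ℕ), 1 ≤ j → Summable fun i => a r i j) (p : ℕ) :
    ∀ (r : ZMod κ), 0 ≤ nseq (fun r j => ∑' i, a r i j) b p r ∧
    mu b a (parent^[p] ⁻¹' {cpt r}) = ENNReal.ofReal (nseq (fun r j => ∑' i, a r i j) b p r) := by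
  induction p with
  | zero => intro r; exact ⟨(hb r).le, mu_singleton b a _⟩
  | succ p ih =>
    intro r
    have h0 : 0 ≤ ∑' i, a r i (p + 1) := tsum_nonneg fun i => (ha r i _ (by omega)).le
    refine ⟨add_nonneg (ih _).1 h0, ?_⟩
    rw [Function.iterate_succ', Set.preimage_comp, pre_cpt, Set.preimage_union,
      measure_union _ MeasurableSet.of_discrete, (ih _).2, Set.preimage_iUnion, measure_iUnion _
      (fun _ => MeasurableSet.of_discrete)]
    · simp only [mu_pre_bpt, nseq]
      rw [ENNReal.ofReal_add (ih _).1 h0, ENNReal.ofReal_tsum_of_nonneg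
        (fun i => (ha r i _ (by omega)).le) (hs _ _ (by omega))]
      congr 2
      funext i
      rw [PNat.one_coe, add_comm]
    · intro i i' hi
      refine Disjoint.preimage _ ?_
      exact Set.disjoint_singleton.2 fun h => hi (eq_of_heq (bpt_inj h).2.1)
    · refine Disjoint.preimage _ ?_
      simpa using fun x h => cpt_ne (Eq.symm h)

lemma main_b {κ : ℕ} [NeZero κ] {η : ZMod κ → ℕ∞} (m k : ℕ) (M : ℝ) (hM : 0 < M)
    (w : (r : ZMod κ) → Br κ η r → Polynomial ℝ)
    (hw : ∀ r i, (w r i).natDegree < m)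
    (b : ZMod κ → ℝ) (hb : ∀ r, 0 < b r)
    (a : (r : ZMod κ) → Br κ η r → ℕ → ℝ) (ha : ∀ r i (j : ℕ), 1 ≤ j → 0 < a r i j)
    (hwa : ∀ r i (j : ℕ), 1 ≤ j → (w r i).eval (j : ℝ) = a r i (k + j))
    (hs : ∀ r (j : ℕ), 1 ≤ j → Summable fun i => a r i j)
    (hratio : ∀ r i (j : ℕ), 1 ≤ j → a r i (j + 1) ≤ M * a r i j)
    (hd : ∀ r, (fwdDiff 1)^[m] (fun p => nseq (fun r j => ∑' i, a r i j) b p r) k = 0) :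
    CompBoundedQuasi κ η (mu b a) k m := by
  set N := nseq (fun r j => ∑' i, a r i j) b with hN
  have hq : ∀ r, 0 ≤ N 1 r / b r := fun r => div_nonneg (mu_pre_cpt b hb a ha hs 1 r).1 (hb r).le
  have hQ : 0 ≤ ∑ r, N 1 r / b r := Finset.sum_nonneg fun r _ => hq r
  refine generic_op parent (mu b a) (Real.toNNReal (M + ∑ r, N 1 r / b r)) ?_ ?_ k m ?_
  · intro x
    rw [mu_singleton]
    rcases x with r | ⟨r, i, j⟩
    · simpa [wt] using hb r
    · simpa [wt] using ha r i j j.2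
  · intro x
    rw [mu_singleton]
    change _ ≤ ENNReal.ofReal _ * _
    rw [← ENNReal.ofReal_mul (by positivity)]
    rcases x with r | ⟨r, i, j⟩
    · have := (mu_pre_cpt b hb a ha hs 1 r).2
      rw [Function.iterate_one] at this
      change mu b a (parent ⁻¹' {cpt r}) ≤ _
      rw [this]
      apply ENNReal.ofReal_le_ofReal
      change N 1 r ≤ _ * b r
      rw [← div_le_iff₀ (hb r)]
      have := Finset.single_le_sum (fun r _ => hq r) (Finset.mem_univ r)
      linarith
    · have := mu_pre_bpt b a 1 r i j
      rw [Function.iterate_one] at this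
      change mu b a (parent ⁻¹' {bpt r i j}) ≤ _
      rw [this]
      apply ENNReal.ofReal_le_ofReal
      change _ ≤ _ * a r i j
      have h1 := hratio r i j j.2
      have h2 := mul_nonneg hQ (ha r i j j.2).le
      linarith
  · intro x
    rcases x with r | ⟨r, i, j⟩
    · refine Eq.trans (congrFun (congrArg _ (funext fun p => ?_)) k) (hd r)
      have := mu_pre_cpt b hb a ha hs p r
      change (mu b a (parent^[p] ⁻¹' {cpt r})).toReal = _
      rw [this.2, ENNReal.toReal_ofReal this.1]
    · refine polyDiff (w r i) m (hw r i) _ k (j : ℕ) fun l => ?_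
      have := mu_pre_bpt b a (k + l) r i j
      change (mu b a (parent^[k + l] ⁻¹' {bpt r i j})).toReal = _
      have hj' : 1 ≤ (j : ℕ) := j.2
      rw [this, ENNReal.toReal_ofReal (ha r i _ (by omega)).le]
      have h := hwa r i (j + l) (by omega)
      push_cast at h
      rw [h]
      congr 1
      ring

/-- completion theorem for composition operators on the one-circuit graph.
Given `κ > m ≥ 2`, `k ≥ 1`, polynomials `w^r_i` of degree at most `m − 2` and positive data
`a^r_{i,j}` with `w^r_i(j) = a^r_{i,k+j}` and a uniform bound `M`, there is a measure `μ`
assigning mass `a^r_{i,j}` to each branch point for which `C_φ` is bounded and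
`k`-quasi-`m`-isometric; moreover, for some `c ∈ ℝ` and every `t > c` the measure obtained
by adding `t` to the mass of each circuit point has the same properties. -/
theorem stmt4 (m κ k : ℕ) (hm : 2 ≤ m) (hκ : m < κ) (hk : 1 ≤ k)
    (η : ZMod κ → ℕ∞) (hη : ∃ r : ZMod κ, η r ≠ 0)
    (M : ℝ) (hM : 0 < M)
    (w : (r : ZMod κ) → Br κ η r → Polynomial ℝ)
    (hw : ∀ r i, (w r i).natDegree ≤ m - 2)
    (a : (r : ZMod κ) → Br κ η r → ℕ → ℝ)
    (ha : ∀ r i (j : ℕ), 1 ≤ j → 0 < a r i j)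
    (hwa : ∀ r i (j : ℕ), 1 ≤ j → (w r i).eval (j : ℝ) = a r i (k + j))
    (hsum : ∀ r : ZMod κ, ∃ s : ℝ, s ≤ M ∧ HasSum (fun i : Br κ η r => a r i 1) s)
    (hratio : ∀ r i (j : ℕ), 1 ≤ j → a r i (j + 1) / a r i j ≤ M) :
    ∃ μ : Measure (GraphX κ η),
      (∀ x : GraphX κ η, 0 < μ {x}) ∧
      (∀ r i (j : ℕ+), μ {bpt r i j} = ENNReal.ofReal (a r i (j : ℕ))) ∧
      CompBoundedQuasi κ η μ k m ∧
      ∃ c : ℝ, ∀ t : ℝ, c < t →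
        ∃ μt : Measure (GraphX κ η),
          (∀ x : GraphX κ η, 0 < μt {x}) ∧
          (∀ r i (j : ℕ+), μt {bpt r i j} = ENNReal.ofReal (a r i (j : ℕ))) ∧
          CompBoundedQuasi κ η μt k m ∧
          (∀ r : ZMod κ,
            μt {cpt r} = ENNReal.ofReal ((μ {cpt r}).toReal + t)) ∧
          (∀ r i (j : ℕ+), μt {bpt r i j} = μ {bpt r i j}) := by
  have : NeZero κ := ⟨by omega⟩
  obtain ⟨m, rfl⟩ : ∃ n, m = n + 2 := ⟨m - 2, by omega⟩
  have hw' : ∀ r i, (w r i).natDegree < m + 1 := fun r i => by have := hw r i; omega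
  have hratio' : ∀ r i (j : ℕ), 1 ≤ j → a r i (j + 1) ≤ M * a r i j := fun r i j hj =>
    (div_le_iff₀ (ha r i j hj)).1 (hratio r i j hj)
  have hs : ∀ r (j : ℕ), 1 ≤ j → Summable fun i => a r i j := by
    intro r j hj
    induction j, hj using Nat.le_induction with
    | base => obtain ⟨s, -, h⟩ := hsum r; exact h.summable
    | succ j hj ih =>
      exact Summable.of_nonneg_of_le (fun i => (ha r i _ (by omega)).le)
        (fun i => hratio' r i j hj) (ih.mul_left M)
  have hA : (fwdDiff 1)^[m + 1] (fun p => ∑ r, ∑' i, a r i (p + 1)) k = 0 := by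
    have hr : ∀ r, ∑ l ∈ Finset.range (m + 1 + 1), ((-1 : ℤ) ^ (m + 1 - l) * (m + 1).choose l) •
        ∑' i, a r i (k + l • 1 + 1) = 0 := by
      intro r
      have h1 := hasSum_sum (s := Finset.range (m + 1 + 1)) fun l _ =>
        ((hs r (k + l • 1 + 1) (by omega)).hasSum.const_smul
          ((-1 : ℤ) ^ (m + 1 - l) * (m + 1).choose l))
      refine h1.unique ?_
      convert hasSum_zero with i
      rw [← polyDiff (w r i) (m + 1) (hw' r i) (fun p => a r i (p + 1)) k 1 (fun l => ?_),
        fwdDiff_iter_eq_sum_shift]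
      have h := hwa r i (1 + l) (by omega)
      push_cast at h
      rw [h]
      congr 1
      ring
    rw [fwdDiff_iter_eq_sum_shift]
    simp only [Finset.smul_sum]
    rw [Finset.sum_comm]
    exact Finset.sum_eq_zero fun r _ => hr r
  obtain ⟨b₀, hb₀⟩ := solver (fun r j => ∑' i, a r i j) (m + 1) k hA
  have hmain : ∀ b : ZMod κ → ℝ, (∀ r, 0 < b r) →
      (∀ r, (fwdDiff 1)^[m + 1 + 1] (fun p => nseq (fun r j => ∑' i, a r i j) b p r) k = 0) →
      (∀ x : GraphX κ η, 0 < mu b a {x}) ∧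
      (∀ r i (j : ℕ+), mu b a {bpt r i j} = ENNReal.ofReal (a r i (j : ℕ))) ∧
      CompBoundedQuasi κ η (mu b a) k (m + 2) := by
    intro b hb hd
    refine ⟨fun x => ?_, fun r i j => ?_, ?_⟩
    · rw [mu_singleton]
      rcases x with r | ⟨r, i, j⟩
      · simpa [wt] using hb r
      · simpa [wt] using ha r i j j.2
    · rw [mu_singleton]; rfl
    · exact main_b (m + 2) k M hM w (fun r i => (hw' r i).trans (by omega)) b hb a ha hwa hs
        hratio' hd
  set t₀ : ℝ := 1 + ∑ r, |b₀ r| with ht₀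
  have hpos : ∀ r, 0 < t₀ + b₀ r := by
    intro r
    have h1 := Finset.single_le_sum (fun r _ => abs_nonneg (b₀ r)) (Finset.mem_univ r)
    have h2 := neg_abs_le (b₀ r)
    linarith
  have hd1 : ∀ r, (fwdDiff 1)^[m + 1 + 1] (fun p => nseq (fun r j => ∑' i, a r i j)
      (fun r => t₀ + b₀ r) p r) k = 0 := fun r => by rw [diff_const_add, hb₀]
  obtain ⟨h1, h2, h3⟩ := hmain _ hpos hd1
  refine ⟨mu (fun r => t₀ + b₀ r) a, h1, h2, h3, 0, fun t ht => ?_⟩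
  obtain ⟨g1, g2, g3⟩ := hmain (fun r => t + (t₀ + b₀ r)) (fun r => add_pos ht (hpos r))
    (fun r => by rw [diff_const_add, hd1])
  refine ⟨_, g1, g2, g3, fun r => ?_, fun r i j => ?_⟩
  · rw [mu_singleton, mu_singleton]
    change ENNReal.ofReal (t + (t₀ + b₀ r)) = ENNReal.ofReal ((ENNReal.ofReal (t₀ + b₀ r)).toReal + t)
    rw [ENNReal.toReal_ofReal (hpos r).le, add_comm]
  · rw [g2, h2]
end
end

section
/- Let m ≥ 2 and k ≥ 1 be integers and let b_1, …, b_m ∈ (0, ∞). Let X = {x_1} ∪ {x_{1,j} : j ≥ 1} be the one-circuit directed-graph space with κ = 1 and a single branch (η_1 = 1), and let φ : X → X be given by φ(x_{1,j+1}) = x_{1,j} for j ≥ 1, φ(x_{1,1}) = x_1, φ(x_1) = x_1. Then there exists a measure μ on the power set of X with all point masses positive such that μ({x_{1,n}}) = b_n for 1 ≤ n ≤ m and the composition operator C_φ is bounded on L²(μ) and k-quasi-(m+2)-isometric. Furthermore, for m = 1 and any b_1 ∈ (0, ∞) there exists such a measure μ with μ({x_{1,1}}) = b_1 for which C_φ is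 bounded on L²(μ) and k-quasi-2-isometric. -/
open MeasureTheory
noncomputable section

variable {E : Type*} [NormedAddCommGroup E] [InnerProductSpace ℂ E] [CompleteSpace E]

/-- The branch-count function for a single branch (`κ = 1`, `η₁ = 1`). -/
def oneBranch : ZMod 1 → ℕ∞ := fun _ => 1

section helpers
open Polynomial

lemma hs_countable {X : Type*} [MeasurableSpace X] [Countable X] [MeasurableSingletonClass X]
    (ν : Measure X) (g : X → ℝ) (hg : Integrable g ν) :
    HasSum (fun x => ν.real {x} * g x) (∫ x, g x ∂ν) := by
  have h := hg
  rw [← Measure.sum_smul_dirac ν] at h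
  have := hasSum_integral_measure h
  rw [Measure.sum_smul_dirac ν] at this
  have e : (fun x => ν.real {x} * g x) = fun x => ∫ y, g y ∂(ν {x} • Measure.dirac x) := by
    ext x
    rw [integral_smul_measure, integral_dirac]
    rfl
  rw [e]
  exact this

lemma le_of_singleton {X : Type*} [MeasurableSpace X] [Countable X] [MeasurableSingletonClass X]
    (μ ν : Measure X) (h : ∀ x, μ {x} ≤ ν {x}) : μ ≤ ν := by
  refine Measure.le_iff.2 fun s hs => ?_
  rw [← Measure.tsum_indicator_apply_singleton μ s hs,
    ← Measure.tsum_indicator_apply_singleton ν s hs]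
  exact ENNReal.tsum_le_tsum fun x => Set.indicator_le_indicator (h x)

lemma exists_comp {X : Type*} [MeasurableSpace X] (μ : Measure X) (φ : X → X)
    (hφ : Measurable φ) (c : ENNReal) (hc : c ≠ ⊤) (hle : μ.map φ ≤ c • μ) :
    ∃ T : Lp ℂ 2 μ →L[ℂ] Lp ℂ 2 μ,
      ∀ f : Lp ℂ 2 μ, (T f : X → ℂ) =ᵐ[μ] fun x => (f : X → ℂ) (φ x) := by
  have hq : μ.map φ ≪ μ := Measure.absolutelyContinuous_of_le_smul hle
  have hm : ∀ f : Lp ℂ 2 μ, MemLp (fun x => (f : X → ℂ) (φ x)) 2 μ := fun f =>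
    MemLp.comp_of_map ((Lp.memLp f).of_measure_le_smul hc hle) hφ.aemeasurable
  have hae : ∀ {p : X → Prop}, (∀ᵐ x ∂μ, p x) → ∀ᵐ x ∂μ, p (φ x) := fun h =>
    ae_of_ae_map hφ.aemeasurable (hq.ae_le h)
  let L : Lp ℂ 2 μ →ₗ[ℂ] Lp ℂ 2 μ :=
    { toFun := fun f => (hm f).toLp _
      map_add' := by
        intro f g
        apply Lp.ext
        filter_upwards [(hm (f + g)).coeFn_toLp, (hm f).coeFn_toLp, (hm g).coeFn_toLp,
          Lp.coeFn_add ((hm f).toLp _) ((hm g).toLp _), hae (Lp.coeFn_add f g)] with x h1 h2 h3 h4 h5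
        rw [h1, h4, h5, Pi.add_apply, Pi.add_apply, h2, h3]
      map_smul' := by
        intro a f
        apply Lp.ext
        filter_upwards [(hm (a • f)).coeFn_toLp, (hm f).coeFn_toLp,
          Lp.coeFn_smul a ((hm f).toLp _), hae (Lp.coeFn_smul a f)] with x h1 h2 h4 h5
        simp only [RingHom.id_apply]
        rw [h1, h4, h5, Pi.smul_apply, Pi.smul_apply, h2] }
  have hb : ∀ f, ‖L f‖ ≤ (c ^ (1 / (2 : ENNReal)).toReal).toReal * ‖f‖ := by
    intro f
    change ‖(hm f).toLp _‖ ≤ _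
    rw [Lp.norm_toLp, Lp.norm_def, ← ENNReal.toReal_mul]
    apply ENNReal.toReal_mono
    · exact ENNReal.mul_ne_top (ENNReal.rpow_ne_top_of_nonneg (by positivity) hc) (Lp.eLpNorm_ne_top f)
    · have h1 := ((Lp.memLp f).of_measure_le_smul hc hle).1
      have := eLpNorm_map_measure (p := 2) h1 hφ.aemeasurable
      change eLpNorm ((f : X → ℂ) ∘ φ) 2 μ ≤ _
      rw [← this]
      exact eLpNorm_le_of_measure_le_smul hle
  exact ⟨L.mkContinuous _ hb, fun f => (hm f).coeFn_toLp⟩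

lemma norm_sq_pow {X : Type*} [MeasurableSpace X] (μ : Measure X) (φ : X → X)
    (hφ : Measurable φ) (hq : μ.map φ ≪ μ)
    (T : Lp ℂ 2 μ →L[ℂ] Lp ℂ 2 μ)
    (hT : ∀ f : Lp ℂ 2 μ, (T f : X → ℂ) =ᵐ[μ] fun x => (f : X → ℂ) (φ x)) (f : Lp ℂ 2 μ)
    (n : ℕ) :
    Integrable (fun x => ‖(f : X → ℂ) x‖ ^ 2) (μ.map φ^[n]) ∧
    ‖(T ^ n) f‖ ^ 2 = ∫ x, ‖(f : X → ℂ) x‖ ^ 2 ∂(μ.map φ^[n]) := by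
  have hqm : Measure.QuasiMeasurePreserving φ μ μ := ⟨hφ, hq⟩
  have h1 : ((T ^ n) f : X → ℂ) =ᵐ[μ] fun x => (f : X → ℂ) (φ^[n] x) := by
    induction n with
    | zero => simp
    | succ n ih =>
      rw [pow_succ', mul_apply_eq_comp]
      filter_upwards [hT ((T ^ n) f), hqm.ae ih] with x h1 h2
      rw [h1, h2, Function.iterate_succ_apply]
  have hm : Measurable φ^[n] := hφ.iterate n
  have hsm : AEStronglyMeasurable (fun x => ‖(f : X → ℂ) x‖ ^ 2) (μ.map φ^[n]) :=
    (((Lp.aestronglyMeasurable f).mono_ac (hqm.iterate n).absolutelyContinuous).norm.pow 2)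
  have h2 : (fun x => ‖((T ^ n) f : X → ℂ) x‖ ^ 2) =ᵐ[μ] fun x => ‖(f : X → ℂ) (φ^[n] x)‖ ^ 2 := by
    filter_upwards [h1] with x h
    rw [h]
  have hi := (Lp.memLp ((T ^ n) f)).integrable_norm_pow (by norm_num)
  constructor
  · rw [integrable_map_measure hsm hm.aemeasurable]
    refine Integrable.congr ?_ h2
    simpa using hi
  · rw [integral_map hm.aemeasurable hsm, ← integral_congr_ae h2]
    have := @inner_self_eq_norm_sq_to_K ℂ _ _ _ _ ((T ^ n) f)
    rw [L2.inner_def] at this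
    simp only [inner_self_eq_norm_sq_to_K] at this
    have h3 : (∫ x, (((‖((T ^ n) f : X → ℂ) x‖ ^ 2 : ℝ)) : ℂ) ∂μ) = ((‖(T ^ n) f‖ ^ 2 : ℝ) : ℂ) := by
      simpa using this
    rw [integral_complex_ofReal] at h3
    exact_mod_cast h3.symm

lemma quasi_of {X : Type*} [MeasurableSpace X] [Countable X] [MeasurableSingletonClass X]
    (μ : Measure X) (φ : X → X)
    (hφ : Measurable φ) (hq : μ.map φ ≪ μ)
    (T : Lp ℂ 2 μ →L[ℂ] Lp ℂ 2 μ)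
    (hT : ∀ f : Lp ℂ 2 μ, (T f : X → ℂ) =ᵐ[μ] fun x => (f : X → ℂ) (φ x)) (k M : ℕ)
    (h : ∀ x, ∑ j ∈ Finset.range (M + 1), ((-1 : ℝ) ^ j * (M.choose j : ℝ)) *
      (μ.map φ^[M - j + k]).real {x} = 0) :
    IsQuasiIsometric k M T := by
  have key : ∀ f : Lp ℂ 2 μ, ∑ j ∈ Finset.range (M + 1), ((-1 : ℝ) ^ j * (M.choose j : ℝ)) *
      ‖(T ^ (M - j + k)) f‖ ^ 2 = 0 := by
    intro f
    have h1 : HasSum (fun x => ∑ j ∈ Finset.range (M + 1), ((-1 : ℝ) ^ j * (M.choose j : ℝ)) *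
      ((μ.map φ^[M - j + k]).real {x} * ‖(f : X → ℂ) x‖ ^ 2))
      (∑ j ∈ Finset.range (M + 1), ((-1 : ℝ) ^ j * (M.choose j : ℝ)) *
      ‖(T ^ (M - j + k)) f‖ ^ 2) := by
      refine hasSum_sum fun j _ => HasSum.mul_left _ ?_
      obtain ⟨a, b⟩ := norm_sq_pow μ φ hφ hq T hT f (M - j + k)
      rw [b]
      exact hs_countable _ _ a
    refine h1.unique ?_
    convert hasSum_zero with x
    rw [← zero_mul (‖(f : X → ℂ) x‖ ^ 2), ← h x, Finset.sum_mul]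
    simp only [mul_assoc]
  have hpow : ∀ n, (ContinuousLinearMap.adjoint T) ^ n = ContinuousLinearMap.adjoint (T ^ n) := by
    intro n
    rw [← ContinuousLinearMap.star_eq_adjoint, ← ContinuousLinearMap.star_eq_adjoint, star_pow]
  unfold IsQuasiIsometric
  rw [← ContinuousLinearMap.coe_inj]
  refine (inner_map_self_eq_zero _).1 fun f => ?_
  have h2 : (ContinuousLinearMap.adjoint T ^ k * Bop M T * T ^ k) f =
      ∑ j ∈ Finset.range (M + 1), ((-1 : ℂ) ^ j * (M.choose j : ℂ)) •
        (ContinuousLinearMap.adjoint (T ^ (M - j + k)) ((T ^ (M - j + k)) f)) := by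
    unfold Bop
    simp only [mul_apply_eq_comp, _root_.sum_apply, map_sum,
      _root_.smul_apply, map_smul]
    refine Finset.sum_congr rfl fun j _ => ?_
    rw [← hpow, add_comm, pow_add, mul_apply_eq_comp, ← add_comm, pow_add T,
      mul_apply_eq_comp]
  change inner ℂ ((ContinuousLinearMap.adjoint T ^ k * Bop M T * T ^ k) f) f = 0
  rw [h2, sum_inner]
  simp only [inner_smul_left, ContinuousLinearMap.adjoint_inner_left, inner_self_eq_norm_sq_to_K]
  have := congrArg (fun r : ℝ => (r : ℂ)) (key f)
  simpa using this

lemma fd_sum (F : ℕ → ℝ) (M k : ℕ) (h : (fwdDiff 1)^[M] F k = 0) :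
    ∑ j ∈ Finset.range (M + 1), ((-1 : ℝ) ^ j * (M.choose j : ℝ)) * F (M - j + k) = 0 := by
  rw [fwdDiff_iter_eq_sum_shift, ← Finset.sum_range_reflect] at h
  rw [← h]
  refine Finset.sum_congr rfl fun j hj => ?_
  have hj' : j ≤ M := by simpa [Nat.lt_succ_iff] using hj
  have e1 : M + 1 - 1 - j = M - j := by omega
  have e2 : M - (M - j) = j := by omega
  rw [e1, e2, Nat.choose_symm hj', add_comm k]
  simp

lemma fd_poly (p : ℝ[X]) (n : ℕ) (h : p.natDegree < n) (y k : ℕ) :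
    (fwdDiff 1)^[n] (fun i : ℕ => p.eval ((i + y : ℕ) : ℝ)) k = 0 := by
  have := congrFun (Polynomial.fwdDiff_iter_eq_zero_of_degree_lt h) ((k + y : ℕ) : ℝ)
  rw [fwdDiff_iter_eq_sum_shift] at this ⊢
  rw [Pi.zero_apply] at this
  rw [← this]
  refine Finset.sum_congr rfl fun j _ => ?_
  congr 2
  push_cast; simp; ring

/-- position of a point along the branch -/
def gpos : GraphX 1 oneBranch → ℕ
  | Sum.inl _ => 0
  | Sum.inr ⟨_, _, j⟩ => (j : ℕ)

lemma gpos_inj : Function.Injective gpos := by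
  rintro (r | ⟨r, ⟨i, hi⟩, j⟩) (r' | ⟨r', ⟨i', hi'⟩, j'⟩) h
  · exact congrArg Sum.inl (Subsingleton.elim (α := ZMod 1) r r')
  · exact absurd h.symm j'.pos.ne'
  · exact absurd h j.pos.ne'
  · obtain rfl : r = r' := Subsingleton.elim (α := ZMod 1) r r'
    have hj : j = j' := PNat.coe_injective h
    have h1 : i ≤ 1 := by have := hi.2; unfold oneBranch at this; exact_mod_cast this
    have h2 : i' ≤ 1 := by have := hi'.2; unfold oneBranch at this; exact_mod_cast this
    obtain rfl : i = i' := by have := hi.1; have := hi'.1; omega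
    rw [hj]

lemma gpos_surj : Function.Surjective gpos := by
  intro n
  rcases Nat.eq_zero_or_pos n with rfl | h
  · exact ⟨cpt 0, rfl⟩
  · exact ⟨bpt 0 ⟨1, le_rfl, by simp [oneBranch]⟩ ⟨n, h⟩, rfl⟩

lemma gpos_parent (x : GraphX 1 oneBranch) : gpos (parent x) = gpos x - 1 := by
  rcases x with r | ⟨r, i, j⟩
  · rfl
  · by_cases h : j = 1
    · subst h
      simp [parent, gpos]
    · have hj : 1 < j := lt_of_le_of_ne (one_le) (Ne.symm h)
      have h2 : (parent (Sum.inr ⟨r, i, j⟩ : GraphX 1 oneBranch)) =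
          (Sum.inr ⟨r, i, j - 1⟩ : GraphX 1 oneBranch) := if_neg h
      have h3 : ((j - 1 : ℕ+) : ℕ) = (j : ℕ) - 1 := by
        rw [PNat.sub_coe, if_pos hj]
        rfl
      rw [h2]
      exact h3

lemma gpos_iter (n : ℕ) (x : GraphX 1 oneBranch) : gpos (parent^[n] x) = gpos x - n := by
  induction n with
  | zero => rfl
  | succ n ih => rw [Function.iterate_succ_apply', gpos_parent, ih, Nat.sub_sub]

instance : Countable (GraphX 1 oneBranch) := gpos_inj.countable

instance : MeasurableSingletonClass (GraphX 1 oneBranch) := ⟨fun _ => trivial⟩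

lemma gmeas (f : GraphX 1 oneBranch → GraphX 1 oneBranch) : Measurable f := fun _ _ => trivial

lemma ratio_bdd_s8 (p : ℝ[X]) (hp : ∀ n : ℕ, 1 ≤ n → 0 < p.eval (n : ℝ)) :
    ∃ C : ℝ, ∀ n : ℕ, 1 ≤ n → p.eval ((n + 1 : ℕ) : ℝ) ≤ C * p.eval (n : ℝ) := by
  have hdeg : (p.comp (X + C 1)).degree = p.degree := by
    have h1 : (p.comp (X + C 1)).natDegree = p.natDegree := by
      rw [natDegree_comp, natDegree_X_add_C, mul_one]
    have hp0 : p ≠ 0 := by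
      rintro rfl
      simpa using hp 1 le_rfl
    have hc0 : p.comp (X + C 1) ≠ 0 := by
      intro h
      have := congrArg (fun q => eval 0 q) h
      have h2 := hp 1 le_rfl
      simp at this h2
      linarith
    rw [degree_eq_natDegree hp0, degree_eq_natDegree hc0, h1]
  have ht := (div_tendsto_atTop_leadingCoeff_div_of_degree_eq _ _ hdeg).comp
    (tendsto_natCast_atTop_atTop (R := ℝ))
  obtain ⟨c, hc⟩ := ht.bddAbove_range
  refine ⟨c, fun n hn => ?_⟩
  have := hc ⟨n, rfl⟩
  simp only [Function.comp, eval_comp, eval_add, eval_X, eval_C] at this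
  rw [div_le_iff₀ (hp n hn)] at this
  push_cast
  exact this

lemma core (p : ℝ[X]) (d k : ℕ) (hd : p.natDegree ≤ d)
    (hp : ∀ n : ℕ, 1 ≤ n → 0 < p.eval (n : ℝ)) :
    ∃ μ : Measure (GraphX 1 oneBranch),
      (∀ x : GraphX 1 oneBranch, 0 < μ {x}) ∧
      (∀ (i : Br 1 oneBranch 0) (n : ℕ+),
        μ {bpt 0 i n} = ENNReal.ofReal (p.eval ((n : ℕ) : ℝ))) ∧
      CompBoundedQuasi 1 oneBranch μ k (d + 2) := by
  let w : ℕ → ℝ := fun n => if n = 0 then 1 else p.eval (n : ℝ)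
  have hw : ∀ n, 0 < w n := by
    intro n
    by_cases h : n = 0
    · simp [w, h]
    · simp only [w, h, if_false]; exact hp n (by omega)
  let μ : Measure (GraphX 1 oneBranch) :=
    Measure.sum fun x => ENNReal.ofReal (w (gpos x)) • Measure.dirac x
  have hμ : ∀ x, μ {x} = ENNReal.ofReal (w (gpos x)) := fun x => Measure.sum_smul_dirac_singleton
  let e := Equiv.ofBijective gpos ⟨gpos_inj, gpos_surj⟩
  have he : ∀ n, gpos (e.symm n) = n := fun n => e.apply_symm_apply n
  let G : ℕ → ℕ → ℝ := fun y n =>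
    if y = 0 then 1 + ∑ i ∈ Finset.range n, p.eval ((i + 1 : ℕ) : ℝ) else p.eval ((n + y : ℕ) : ℝ)
  have hG0 : ∀ y n, 0 ≤ G y n := by
    intro y n
    by_cases h : y = 0
    · simp only [G, h, if_true]
      have := Finset.sum_nonneg (s := Finset.range n) (f := fun i => p.eval ((i + 1 : ℕ) : ℝ))
        fun i _ => (hp (i + 1) (by omega)).le
      linarith
    · simp only [G, h, if_false]; exact (hp _ (by omega)).le
  have hG : ∀ n x, (μ.map parent^[n]) {x} = ENNReal.ofReal (G (gpos x) n) := by
    intro n x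
    rw [Measure.map_apply (gmeas _) (MeasurableSet.singleton x)]
    by_cases h : gpos x = 0
    · have hs : parent^[n] ⁻¹' {x} =
          (((Finset.range (n + 1)).map e.symm.toEmbedding : Finset _) : Set _) := by
        ext z
        simp only [Set.mem_preimage, Set.mem_singleton_iff, Finset.coe_map, Set.mem_image,
          Finset.coe_range, Set.mem_Iio, Equiv.coe_toEmbedding]
        rw [← gpos_inj.eq_iff, gpos_iter, h]
        constructor
        · intro hz
          exact ⟨gpos z, by omega, e.symm_apply_apply z⟩
        · rintro ⟨m, hm, rfl⟩
          rw [he]; omega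
      rw [hs, ← sum_measure_singleton, Finset.sum_map]
      simp only [Equiv.coe_toEmbedding, hμ, he]
      rw [← ENNReal.ofReal_sum_of_nonneg fun i _ => (hw i).le, Finset.sum_range_succ']
      simp [G, h, w, add_comm]
    · have hs : parent^[n] ⁻¹' {x} = {e.symm (n + gpos x)} := by
        ext z
        simp only [Set.mem_preimage, Set.mem_singleton_iff]
        rw [← gpos_inj.eq_iff, ← gpos_inj.eq_iff, gpos_iter, he]
        omega
      rw [hs, hμ, he]
      simp [G, h, w]
  refine ⟨μ, fun x => ?_, fun i n => ?_, ?_⟩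
  · rw [hμ]; simpa using hw _
  · rw [hμ]
    have : gpos (bpt 0 i n) = (n : ℕ) := rfl
    rw [this]
    simp [w]
  · obtain ⟨c, hc⟩ := ratio_bdd_s8 p hp
    let C' : ℝ := max (max c 0) (1 + p.eval 1)
    have hC0 : 0 ≤ C' := (le_max_right c 0).trans (le_max_left _ _)
    have hle : μ.map parent ≤ ENNReal.ofReal C' • μ := by
      refine le_of_singleton _ _ fun x => ?_
      have := hG 1 x
      rw [Function.iterate_one] at this
      rw [this, Measure.smul_apply, hμ, smul_eq_mul, ← ENNReal.ofReal_mul hC0]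
      apply ENNReal.ofReal_le_ofReal
      by_cases h : gpos x = 0
      · simp [G, h, w, C']
      · simp only [G, h, w, if_false]
        rw [add_comm]
        refine (hc _ (by omega)).trans ?_
        refine mul_le_mul_of_nonneg_right ((le_max_left c 0).trans (le_max_left _ _)) ?_
        exact (hp _ (by omega)).le
    obtain ⟨T, hT⟩ := exists_comp μ parent (gmeas _) _ ENNReal.ofReal_ne_top hle
    refine ⟨T, hT, quasi_of μ parent (gmeas _) (Measure.absolutelyContinuous_of_le_smul hle) T hT
      k (d + 2) fun x => ?_⟩
    simp only [Measure.real, hG, ENNReal.toReal_ofReal (hG0 _ _)]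
    apply fd_sum (G (gpos x))
    by_cases h : gpos x = 0
    · have : fwdDiff 1 (G (gpos x)) = fun i : ℕ => p.eval ((i + 1 : ℕ) : ℝ) := by
        ext i
        simp [fwdDiff, G, h, Finset.sum_range_succ]
      rw [Function.iterate_succ_apply, this]
      exact fd_poly p (d + 1) (by omega) 1 k
    · have : G (gpos x) = fun i : ℕ => p.eval ((i + gpos x : ℕ) : ℝ) := by
        ext i
        simp [G, h]
      rw [this]
      exact fd_poly p (d + 2) (by omega) _ k

lemma interp (m : ℕ) (b : ℕ → ℝ) (hb : ∀ n : ℕ, 1 ≤ n → n ≤ m → 0 < b n) :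
    ∃ p : ℝ[X], p.natDegree ≤ m ∧ (∀ n : ℕ, 1 ≤ n → n ≤ m → p.eval (n : ℝ) = b n) ∧
      ∀ n : ℕ, 1 ≤ n → 0 < p.eval (n : ℝ) := by
  let s := Finset.Icc 1 m
  let v : ℕ → ℝ := fun n => n
  have hv : Set.InjOn v s := Nat.cast_injective.injOn
  let q := Lagrange.interpolate s v b
  let N := Lagrange.nodal s v
  have hcard : s.card = m := by simp [s]
  have hN : N.degree = m := by rw [Lagrange.degree_nodal, hcard]
  have hq : q.degree < m := by
    have := Lagrange.degree_interpolate_lt b hv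
    rwa [hcard] at this
  have hqe : ∀ n : ℕ, 1 ≤ n → n ≤ m → q.eval (n : ℝ) = b n := fun n h1 h2 =>
    Lagrange.eval_interpolate_at_node b hv (Finset.mem_Icc.2 ⟨h1, h2⟩)
  have hNe : ∀ n : ℕ, 1 ≤ n → n ≤ m → N.eval (n : ℝ) = 0 := fun n h1 h2 =>
    Lagrange.eval_nodal_at_node (v := v) (Finset.mem_Icc.2 ⟨h1, h2⟩)
  have hNp : ∀ n : ℕ, m < n → 0 < N.eval (n : ℝ) := by
    intro n hn
    rw [Lagrange.eval_nodal]
    refine Finset.prod_pos fun i hi => ?_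
    have : i < n := by have := (Finset.mem_Icc.1 hi).2; omega
    have : (i : ℝ) < n := by exact_mod_cast this
    simp only [v]; linarith
  have ht := (div_tendsto_atTop_zero_of_degree_lt q N (by rw [hN]; exact hq)).comp
    (tendsto_natCast_atTop_atTop (R := ℝ))
  obtain ⟨c, hc⟩ := ht.bddBelow_range
  have hval : ∀ n : ℕ, 1 ≤ n → n ≤ m → (q + C (1 - c) * N).eval (n : ℝ) = b n := by
    intro n h1 h2
    simp [hqe n h1 h2, hNe n h1 h2]
  refine ⟨q + C (1 - c) * N, ?_, hval, ?_⟩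
  · rw [natDegree_le_iff_degree_le]
    refine (degree_add_le _ _).trans (max_le hq.le ?_)
    rw [← hN]
    by_cases h0 : (1 - c) = 0
    · simp [h0]
    · rw [degree_C_mul h0]
  · intro n h1
    by_cases h2 : n ≤ m
    · rw [hval n h1 h2]; exact hb n h1 h2
    · have h3 := hNp n (by omega)
      have := hc ⟨n, rfl⟩
      simp only [Function.comp] at this
      rw [le_div_iff₀ h3] at this
      simp only [eval_add, eval_mul, eval_C]
      nlinarith

end helpers

/-- completion for composition operators on the graph with one circuit
element and one branch.  Given `m ≥ 2`, `k ≥ 1` and `b_1, …, b_m ∈ (0, ∞)`, there is a measure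
`μ` with all point masses positive, `μ({x_{1,n}}) = b_n` for `1 ≤ n ≤ m`, for which `C_φ` is
bounded on `L²(μ)` and `k`-quasi-`(m+2)`-isometric.  Moreover, for `m = 1` and any
`b₁ ∈ (0, ∞)` there is such a measure for which `C_φ` is bounded and `k`-quasi-`2`-isometric. -/
theorem stmt8 (m k : ℕ) (hm : 2 ≤ m) (hk : 1 ≤ k)
    (b : ℕ → ℝ) (hb : ∀ n : ℕ, 1 ≤ n → n ≤ m → 0 < b n) :
    (∃ μ : Measure (GraphX 1 oneBranch),
      (∀ x : GraphX 1 oneBranch, 0 < μ {x}) ∧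
      (∀ (i : Br 1 oneBranch 0) (n : ℕ+), (n : ℕ) ≤ m →
        μ {bpt 0 i n} = ENNReal.ofReal (b (n : ℕ))) ∧
      CompBoundedQuasi 1 oneBranch μ k (m + 2))
    ∧
    (∀ b1 : ℝ, 0 < b1 →
      ∃ μ : Measure (GraphX 1 oneBranch),
        (∀ x : GraphX 1 oneBranch, 0 < μ {x}) ∧
        (∀ i : Br 1 oneBranch 0, μ {bpt 0 i 1} = ENNReal.ofReal b1) ∧
        CompBoundedQuasi 1 oneBranch μ k 2) := by
  refine ⟨?_, ?_⟩
  · obtain ⟨p, h1, h2, h3⟩ := interp m b hb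
    obtain ⟨μ, a, c, e⟩ := core p m k h1 h3
    exact ⟨μ, a, fun i n hn => by rw [c, h2 n n.pos hn], e⟩
  · intro b1 hb1
    obtain ⟨μ, a, c, e⟩ := core (Polynomial.C b1) 0 k (by simp) (by simpa using fun _ _ => hb1)
    exact ⟨μ, a, fun i => by rw [c]; simp, e⟩
end
end
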